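/- arXiv:1312.3857 — 2 statements merged into one kernel-verified Lean document; each statement's English description precedes it below -/
import Mathlib

section
/- Let C be a hyperoctahedral category of partitions with C ≠ ⟨⊓⊓⟩. Then the fat crossing partition belongs to C. -/
/-!
Basic combinatorics of categories of partitions (Banica–Speicher easy quantum groups).

A partition with `k` upper and `l` lower points is encoded as an equivalence
relation (a `Setoid`) on the set `Fin k ⊕ Fin l` of its points; its blocks are
the equivalence classes.
-/

namespace EasyQG

/-- A partition of `k` upper and `l` lower points into blocks. -/
abbrev Partition (k l : ℕ) : Type := Setoid (Fin k ⊕ Fin l)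

/-- The relation "lying in the same block" of a partition. -/
def inSameBlock {k l : ℕ} (p : Partition k l) :
    (Fin k ⊕ Fin l) → (Fin k ⊕ Fin l) → Prop :=
  @Setoid.r _ p

/-- The partition in `P(0,n)` associated to a word: two points lie in the same
block iff they carry the same letter. -/
def ofWord {n : ℕ} (w : Fin n → ℕ) : Partition 0 n :=
  Setoid.ker (Sum.elim Fin.elim0 w)

/-- The partition in `P(0,n)` associated to a word given as a list of letters. -/
def ofList (w : List ℕ) : Partition 0 w.length :=
  ofWord w.get

/-- The identity partition `|` in `P(1,1)`: one upper point joined to one lower point. -/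
def idPartition : Partition 1 1 := ⊤

/-- The pair partition `⊓` in `P(0,2)`: two points in one block. -/
def pairPartition : Partition 0 2 := ⊤

/-- The double singleton `↓⊗↓` in `P(0,2)`: two points in two different blocks. -/
def doubleSingleton : Partition 0 2 := ⊥

/-- The four block partition `⊓⊓` in `P(0,4)`: four points in one block (word `aaaa`). -/
def fourBlock : Partition 0 4 := ⊤

/-- The fat crossing partition in `P(4,4)`, with blocks `{1,2,3',4'}` and `{3,4,1',2'}`. -/
def fatCross : Partition 4 4 :=
  Setoid.ker (Sum.elim (fun i => decide (i.val < 2)) (fun j => decide (2 ≤ j.val)))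

/-- The pair positioner partition in `P(3,3)`, with blocks `{1,2,2',3'}` and `{3,1'}`. -/
def pairPositioner : Partition 3 3 :=
  Setoid.ker (Sum.elim (fun i => decide (i.val < 2)) (fun j => decide (1 ≤ j.val)))

/-- The `s`-mixing partition `h_s ∈ P(0,2s)`, the word `abab…ab` of length `2s`. -/
def sMixing (s : ℕ) : Partition 0 (2 * s) := ofWord (fun i => i.val % 2)

/-- The partition `π_k ∈ P(0,4k)`, the word `a₁…a_k a_k…a₁ a₁…a_k a_k…a₁`
in `k` distinct letters. -/
def piPartition (k : ℕ) : Partition 0 (4 * k) :=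
  ofWord (fun i =>
    if i.val % (2 * k) < k then i.val % (2 * k) else 2 * k - 1 - i.val % (2 * k))

/-- The disjoint sum of two set partitions. -/
def sumSetoid {α β : Type*} (ra : Setoid α) (rb : Setoid β) : Setoid (α ⊕ β) where
  r := Sum.LiftRel (@Setoid.r _ ra) (@Setoid.r _ rb)
  iseqv := by
    constructor
    · intro x
      cases x with
      | inl a => exact Sum.LiftRel.inl (ra.iseqv.refl a)
      | inr b => exact Sum.LiftRel.inr (rb.iseqv.refl b)
    · intro x y h
      cases h with
      | inl h => exact Sum.LiftRel.inl (ra.iseqv.symm h)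
      | inr h => exact Sum.LiftRel.inr (rb.iseqv.symm h)
    · intro x y z h1 h2
      cases h1 with
      | inl h1 => cases h2 with
        | inl h2 => exact Sum.LiftRel.inl (ra.iseqv.trans h1 h2)
      | inr h1 => cases h2 with
        | inr h2 => exact Sum.LiftRel.inr (rb.iseqv.trans h1 h2)

/-- Tensor product (horizontal concatenation) of partitions. -/
def tensor {k l k' l' : ℕ} (p : Partition k l) (q : Partition k' l') :
    Partition (k + k') (l + l') :=
  Setoid.comap
    (fun x => (Equiv.sumSumSumComm (Fin k) (Fin k') (Fin l) (Fin l'))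
      (Sum.map finSumFinEquiv.symm finSumFinEquiv.symm x))
    (sumSetoid p q)

/-- Composition (vertical concatenation) of partitions `p ∈ P(k,l)` and `q ∈ P(l,m)`:
blocks are joined along the `l` middle points, which are then deleted. -/
def comp {k l m : ℕ} (p : Partition k l) (q : Partition l m) : Partition k m :=
  Setoid.comap (Sum.map id Sum.inr)
    (Relation.EqvGen.setoid (fun x y : Fin k ⊕ (Fin l ⊕ Fin m) =>
      (∃ a b, inSameBlock p a b ∧ Sum.map id Sum.inl a = x ∧ Sum.map id Sum.inl b = y) ∨
      (∃ a b, inSameBlock q a b ∧ Sum.inr a = x ∧ Sum.inr b = y)))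

/-- Involution (turning a partition upside down). -/
def involution {k l : ℕ} (p : Partition k l) : Partition l k :=
  Setoid.comap Sum.swap p

/-- Rotation moving the leftmost upper point to the left end of the lower row. -/
def rotUL {k l : ℕ} (p : Partition (k + 1) l) : Partition k (l + 1) :=
  Setoid.comap
    (Sum.elim (fun i => Sum.inl i.succ)
      (fun j => Fin.cases (Sum.inl (0 : Fin (k + 1))) (fun j' => Sum.inr j') j)) p

/-- Rotation moving the leftmost lower point to the left end of the upper row. -/
def rotLU {k l : ℕ} (p : Partition k (l + 1)) : Partition (k + 1) l :=
  Setoid.comap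
    (Sum.elim (fun i => Fin.cases (Sum.inr (0 : Fin (l + 1))) (fun i' => Sum.inl i') i)
      (fun j => Sum.inr j.succ)) p

/-- Rotation moving the rightmost upper point to the right end of the lower row. -/
def rotUR {k l : ℕ} (p : Partition (k + 1) l) : Partition k (l + 1) :=
  Setoid.comap
    (Sum.elim (fun i => Sum.inl i.castSucc)
      (fun j => Fin.lastCases (Sum.inl (Fin.last k)) (fun j' => Sum.inr j') j)) p

/-- Rotation moving the rightmost lower point to the right end of the upper row. -/
def rotRU {k l : ℕ} (p : Partition k (l + 1)) : Partition (k + 1) l :=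
  Setoid.comap
    (Sum.elim (fun i => Fin.lastCases (Sum.inr (Fin.last l)) (fun i' => Sum.inl i') i)
      (fun j => Sum.inr j.castSucc)) p

/-- A category of partitions: a collection of partitions containing the identity
partition and closed under the category operations (tensor product, composition,
involution and the four rotations). -/
structure PartitionCategory where
  mem : Set (Σ k l : ℕ, Partition k l)
  id_mem : ⟨1, 1, idPartition⟩ ∈ mem
  tensor_mem : ∀ {k l k' l' : ℕ} {p : Partition k l} {q : Partition k' l'},
    ⟨k, l, p⟩ ∈ mem → ⟨k', l', q⟩ ∈ mem → ⟨k + k', l + l', tensor p q⟩ ∈ mem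
  comp_mem : ∀ {k l m : ℕ} {p : Partition k l} {q : Partition l m},
    ⟨k, l, p⟩ ∈ mem → ⟨l, m, q⟩ ∈ mem → ⟨k, m, comp p q⟩ ∈ mem
  involution_mem : ∀ {k l : ℕ} {p : Partition k l},
    ⟨k, l, p⟩ ∈ mem → ⟨l, k, involution p⟩ ∈ mem
  rotUL_mem : ∀ {k l : ℕ} {p : Partition (k + 1) l},
    ⟨k + 1, l, p⟩ ∈ mem → ⟨k, l + 1, rotUL p⟩ ∈ mem
  rotLU_mem : ∀ {k l : ℕ} {p : Partition k (l + 1)},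
    ⟨k, l + 1, p⟩ ∈ mem → ⟨k + 1, l, rotLU p⟩ ∈ mem
  rotUR_mem : ∀ {k l : ℕ} {p : Partition (k + 1) l},
    ⟨k + 1, l, p⟩ ∈ mem → ⟨k, l + 1, rotUR p⟩ ∈ mem
  rotRU_mem : ∀ {k l : ℕ} {p : Partition k (l + 1)},
    ⟨k, l + 1, p⟩ ∈ mem → ⟨k + 1, l, rotRU p⟩ ∈ mem

/-- The members of the smallest category of partitions containing `S`
(the category `⟨S⟩` generated by `S`). -/
def generated (S : Set (Σ k l : ℕ, Partition k l)) : Set (Σ k l : ℕ, Partition k l) :=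
  {x | ∀ C : PartitionCategory, S ⊆ C.mem → x ∈ C.mem}

/-- A category of partitions is hyperoctahedral if it contains the four block
partition `⊓⊓` but not the double singleton `↓⊗↓`. -/
def Hyperoctahedral (C : PartitionCategory) : Prop :=
  (⟨0, 4, fourBlock⟩ : Σ k l : ℕ, Partition k l) ∈ C.mem ∧
    (⟨0, 2, doubleSingleton⟩ : Σ k l : ℕ, Partition k l) ∉ C.mem

/-- A category of partitions is group-theoretical if it contains the pair
positioner partition. -/
def GroupTheoretical (C : PartitionCategory) : Prop :=
  (⟨3, 3, pairPositioner⟩ : Σ k l : ℕ, Partition k l) ∈ C.mem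

/-- The generating set `{π_l | 1 ≤ l ≤ k}`. -/
def piUpTo (k : ℕ) : Set (Σ k l : ℕ, Partition k l) :=
  {x | ∃ l : ℕ, 1 ≤ l ∧ l ≤ k ∧ x = ⟨0, 4 * l, piPartition l⟩}

/-- The generating set `{π_l | l ∈ ℕ, l ≥ 1}`. -/
def piAll : Set (Σ k l : ℕ, Partition k l) :=
  {x | ∃ l : ℕ, 1 ≤ l ∧ x = ⟨0, 4 * l, piPartition l⟩}

end EasyQG
namespace EasyQG

/-- Merging the blocks of the points `x` and `y` of a partition. -/
def merge {k l : ℕ} (p : Partition k l) (x y : Fin k ⊕ Fin l) : Partition k l :=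
  Relation.EqvGen.setoid (fun u v => inSameBlock p u v ∨ (u = x ∧ v = y) ∨ (u = y ∧ v = x))

/-- The word `a_{i(1)}^{k(1)} … a_{i(m)}^{k(m)}` determined by a list of
letters with exponents. -/
def expand (blocks : List (ℕ × ℕ)) : List ℕ :=
  (blocks.map fun be => List.replicate be.2 be.1).flatten

/-- The run decomposition of a word: the list of its (letter, exponent) blocks. -/
def runs : List ℕ → List (ℕ × ℕ)
  | [] => []
  | a :: rest =>
    match runs rest with
    | [] => [(a, 1)]
    | (b, e) :: rs => if a = b then (b, e + 1) :: rs else (a, 1) :: (b, e) :: rs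

/-- The single-double leg form associated to a word: every odd exponent is
replaced by `1` and every even exponent by `2`. -/
def sdForm (w : List ℕ) : List ℕ :=
  expand ((runs w).map fun be => (be.1, if Odd be.2 then 1 else 2))

/-- A word is in single-double leg form if all its exponents are `1` or `2`. -/
def IsSingleDoubleLegForm (w : List ℕ) : Prop :=
  ∃ blocks : List (ℕ × ℕ), List.Chain' (fun x y => x.1 ≠ y.1) blocks ∧
    (∀ b ∈ blocks, b.2 = 1 ∨ b.2 = 2) ∧ w = expand blocks

/-- The vertical reflection of a partition: the left-to-right order of the
points is reversed in both rows, keeping the block structure. -/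
def verticalReflect {k l : ℕ} (p : Partition k l) : Partition k l :=
  Setoid.comap (Sum.map Fin.rev Fin.rev) p

/-- `leg [a₁,…,a_k] [X₁,…,X_{k-1}] = a₁ X₁ a₂ X₂ … a_{k-1} X_{k-1} a_k`:
a list of letters interleaved with filler words. -/
def leg : List ℕ → List (List ℕ) → List ℕ
  | [], _ => []
  | [a], _ => [a]
  | a :: rest, Xs => a :: (Xs.headD [] ++ leg rest Xs.tail)

/-- A word contains a W of depth `k` if it can be written as
`Y₁ S_α X_k^α S_β Y₂ S_γ X_k^γ S_δ Y₃`, where `S_α = a₁X₁^α a₂X₂^α…a_k`,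
`S_β = a_k X_{k-1}^β…X₁^β a₁`, `S_γ = a₁X₁^γ…a_k`, `S_δ = a_k X_{k-1}^δ…X₁^δ a₁`
for `k` distinct letters `a₁,…,a_k`, each of which occurs an odd number of
times in each of `S_α`, `S_β`, `S_γ`, `S_δ`. -/
def ContainsW (w : List ℕ) (k : ℕ) : Prop :=
  ∃ (as : List ℕ) (Xa Xb Xc Xd : List (List ℕ)) (Xka Xkc Y1 Y2 Y3 : List ℕ),
    as.length = k ∧ as.Nodup ∧
    Xa.length = k - 1 ∧ Xb.length = k - 1 ∧ Xc.length = k - 1 ∧ Xd.length = k - 1 ∧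
    w = Y1 ++ leg as Xa ++ Xka ++ leg as.reverse Xb ++ Y2 ++
        leg as Xc ++ Xkc ++ leg as.reverse Xd ++ Y3 ∧
    ∀ a ∈ as, Odd ((leg as Xa).count a) ∧ Odd ((leg as.reverse Xb).count a) ∧
      Odd ((leg as Xc).count a) ∧ Odd ((leg as.reverse Xd).count a)

/-- `wdepth w` is the maximal `k` such that some rotated version of the
word `w` contains a W of depth `k`. -/
noncomputable def wdepth (w : List ℕ) : ℕ :=
  sSup {k | ∃ r : ℕ, ContainsW (w.rotate r) k}

end EasyQG

namespace EasyQG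

/-- Membership of the partition with upper labels `f` and lower labels `g`. -/
def Q (C : PartitionCategory) {k l : ℕ} (f : Fin k → ℕ) (g : Fin l → ℕ) : Prop :=
  (⟨k, l, Setoid.ker (Sum.elim f g)⟩ : Σ k l : ℕ, Partition k l) ∈ C.mem

theorem Q_congr {C : PartitionCategory} {k l k' l' : ℕ} {f : Fin k → ℕ} {g : Fin l → ℕ}
    {f' : Fin k' → ℕ} {g' : Fin l' → ℕ} (h : Q C f g) (hk : k = k') (hl : l = l')
    (H : ∀ x y : Fin k ⊕ Fin l, Sum.elim f g x = Sum.elim f g y ↔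
      Sum.elim f' g' (Sum.map (Fin.cast hk) (Fin.cast hl) x) =
      Sum.elim f' g' (Sum.map (Fin.cast hk) (Fin.cast hl) y)) : Q C f' g' := by
  subst hk hl
  unfold Q at *
  have : Setoid.ker (Sum.elim f g) = Setoid.ker (Sum.elim f' g') := by
    ext x y
    have := H x y
    simpa [Setoid.ker_def] using this
  rwa [← this]

theorem Q_cast {C : PartitionCategory} {k l k' l' : ℕ} {f : Fin k → ℕ} {g : Fin l → ℕ}
    {f' : Fin k' → ℕ} {g' : Fin l' → ℕ} (h : Q C f g) (hk : k = k') (hl : l = l')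
    (Hf : ∀ i, f i = f' (Fin.cast hk i)) (Hg : ∀ i, g i = g' (Fin.cast hl i)) : Q C f' g' := by
  refine Q_congr h hk hl ?_
  rintro (x | x) (y | y) <;> simp [Hf, Hg]

/-- Two-row words. -/
def P2 (C : PartitionCategory) (up lo : List ℕ) : Prop := Q C up.get lo.get

/-- One-row words. -/
abbrev W (C : PartitionCategory) (w : List ℕ) : Prop := P2 C [] w

theorem mem_eq {C : PartitionCategory} {k l : ℕ} {p q : Partition k l}
    (h : (⟨k, l, p⟩ : Σ k l : ℕ, Partition k l) ∈ C.mem) (e : q = p) :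
    (⟨k, l, q⟩ : Σ k l : ℕ, Partition k l) ∈ C.mem := e ▸ h

theorem comap_ker' {α β γ : Type*} (g : α → β) (f : β → γ) (h : α → γ) (e : h = f ∘ g) :
    Setoid.ker h = Setoid.comap g (Setoid.ker f) := by subst e; rfl

section
variable {C : PartitionCategory}

theorem P2_rotUL {a : ℕ} {up lo : List ℕ} (h : P2 C (a :: up) lo) : P2 C up (a :: lo) := by
  have := C.rotUL_mem (k := up.length) h
  refine mem_eq this (comap_ker' _ _ _ ?_)
  funext x
  rcases x with x | x
  · rfl
  · refine Fin.cases ?_ (fun j => ?_) x <;> rfl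

theorem P2_rotLU {a : ℕ} {up lo : List ℕ} (h : P2 C up (a :: lo)) : P2 C (a :: up) lo := by
  have := C.rotLU_mem (l := lo.length) h
  refine mem_eq this (comap_ker' _ _ _ ?_)
  funext x
  rcases x with x | x
  · refine Fin.cases ?_ (fun j => ?_) x <;> rfl
  · rfl

theorem P2_inv {up lo : List ℕ} (h : P2 C up lo) : P2 C lo up := by
  have := C.involution_mem h
  refine mem_eq this (comap_ker' _ _ _ ?_)
  funext x
  rcases x with x | x <;> rfl

theorem P2_rotUR {a : ℕ} {lo : List ℕ} (h : P2 C [a] lo) : W C (lo ++ [a]) := by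
  have := C.rotUR_mem (k := 0) h
  have h2 : Q C (k := 0) (l := lo.length + 1) (Fin.elim0) (Fin.lastCases a lo.get) := by
    refine mem_eq this (comap_ker' _ _ _ ?_)
    funext x
    rcases x with x | x
    · exact x.elim0
    · refine Fin.lastCases ?_ (fun j => ?_) x <;> simp
  refine Q_cast h2 rfl (by simp) (fun i => i.elim0) ?_
  intro i
  refine Fin.lastCases ?_ (fun j => ?_) i <;> simp

theorem P2_word {up lo : List ℕ} : P2 C up lo ↔ W C (up.reverse ++ lo) := by
  induction up generalizing lo with
  | nil => simp
  | cons a up ih =>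
    have : P2 C (a :: up) lo ↔ P2 C up (a :: lo) := ⟨P2_rotUL, P2_rotLU⟩
    rw [this, ih]; simp

theorem W_rev {w : List ℕ} (h : W C w) : W C w.reverse := by
  simpa using P2_word.1 (P2_inv h)

theorem W_rot {x y : List ℕ} (h : W C (x ++ y)) : W C (y ++ x) := by
  induction x generalizing y with
  | nil => simpa using h
  | cons a x ih =>
    have : W C ((x ++ y) ++ [a]) := P2_rotUR (P2_rotLU h)
    rw [List.append_assoc] at this
    simpa using ih this

theorem P2_tensor {u l u' l' : List ℕ} (h : P2 C u l) (h' : P2 C u' l')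
    (hd : ∀ a ∈ u ++ l, ∀ b ∈ u' ++ l', a ≠ b) : P2 C (u ++ u') (l ++ l') := by
  have := C.tensor_mem h h'
  have h2 : Q C (Fin.append u.get u'.get) (Fin.append l.get l'.get) := by
    refine mem_eq this ?_
    ext x y
    unfold tensor
    have H : ∀ x : Fin (u.length + u'.length) ⊕ Fin (l.length + l'.length),
      Sum.elim (Fin.append u.get u'.get) (Fin.append l.get l'.get) x =
      Sum.elim (Sum.elim u.get l.get) (Sum.elim u'.get l'.get)
      ((Equiv.sumSumSumComm _ _ _ _) (Sum.map finSumFinEquiv.symm finSumFinEquiv.symm x)) := by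
      rintro (x | x) <;> refine Fin.addCases (fun i => ?_) (fun i => ?_) x <;> simp
    rw [Setoid.ker_def, H, H, Setoid.comap_rel]
    generalize (Equiv.sumSumSumComm _ _ _ _) (Sum.map finSumFinEquiv.symm finSumFinEquiv.symm x) = x
    generalize (Equiv.sumSumSumComm _ _ _ _) (Sum.map finSumFinEquiv.symm finSumFinEquiv.symm y) = y
    have m1 : ∀ x, Sum.elim u.get l.get x ∈ u ++ l := by rintro (x | x) <;> simp
    have m2 : ∀ x, Sum.elim u'.get l'.get x ∈ u' ++ l' := by rintro (x | x) <;> simp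
    change _ ↔ Sum.LiftRel _ _ _ _
    rcases x with x | x <;> rcases y with y | y
    · rw [Sum.liftRel_inl_inl]; rfl
    · have := hd _ (m1 x) _ (m2 y)
      simp only [Sum.elim_inl, Sum.elim_inr, this, Sum.not_liftRel_inl_inr]
    · have := (hd _ (m1 y) _ (m2 x)).symm
      simp only [Sum.elim_inl, Sum.elim_inr, this, Sum.not_liftRel_inr_inl]
    · rw [Sum.liftRel_inr_inr]; rfl
  refine Q_cast h2 (by simp) (by simp) ?_ ?_
  · intro i
    refine Fin.addCases (fun i => ?_) (fun i => ?_) i <;> simp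
  · intro i
    refine Fin.addCases (fun i => ?_) (fun i => ?_) i <;> simp

theorem P2_id (a : ℕ) : P2 C [a] [a] := by
  have := C.id_mem
  refine mem_eq this ?_
  ext x y
  rw [Setoid.ker_def]
  change _ ↔ True
  rcases x with x | x <;> rcases y with y | y <;> simp

theorem P2_idn (L : List ℕ) (hL : L.Nodup) : P2 C L L := by
  induction L with
  | nil =>
    -- the empty partition: compose the pair with its reflection
    have h1 : P2 C [0, 0] [] := P2_rotLU (P2_id 0)
    have := C.comp_mem (P2_inv h1) h1
    refine mem_eq this ?_
    ext x; rcases x with x | x <;> exact x.elim0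
  | cons a L ih =>
    rw [List.nodup_cons] at hL
    refine P2_tensor (P2_id a) (ih hL.2) ?_
    rintro c hc b hb rfl
    simp at hc hb
    subst hc
    exact hL.1 hb

theorem W_nil : W C [] := P2_idn [] List.nodup_nil

theorem W_relabel {w : List ℕ} {f g : ℕ → ℕ} (h : W C (w.map f))
    (H : ∀ c ∈ w, ∀ d ∈ w, f c = f d ↔ g c = g d) : W C (w.map g) := by
  refine Q_congr h rfl (by simp) ?_
  rintro (x | x) (y | y)
  · exact x.elim0
  · exact x.elim0
  · exact y.elim0
  · simp; apply H <;> simp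

theorem W_relabel' {w : List ℕ} {g : ℕ → ℕ} (h : W C w)
    (H : ∀ c ∈ w, ∀ d ∈ w, c = d ↔ g c = g d) : W C (w.map g) :=
  W_relabel (f := id) (by simpa using h) H

theorem W_cap {a b : ℕ} {w : List ℕ} (h : W C (a :: b :: w)) {g : ℕ → ℕ}
    (hg : ∀ c ∈ w, ∀ d ∈ w, g c = g d ↔ c = d ∨ ((c = a ∨ c = b) ∧ (d = a ∨ d = b))) :
    W C (w.map g) := by
  set n := w.length with hn
  have hq : P2 C (0 :: 0 :: (List.range n).map Nat.succ) ((List.range n).map Nat.succ) := by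
    refine P2_tensor (u := [0, 0]) (l := []) (P2_rotLU (P2_id 0)) (P2_idn _ ?_) ?_
    · exact List.nodup_range.map Nat.succ_injective
    · rintro c hc b hb rfl
      simp at hc hb
      subst hc
      simp at hb
  have hq' : Q C (k := n + 2) (l := n) (fun i => i.val - 1) (fun i => i.val + 1) := by
    refine Q_cast hq (by simp) (by simp) ?_ ?_
    · rintro ⟨i, hi⟩
      match i with
      | 0 => rfl
      | 1 => rfl
      | i + 2 => simp
    · simp
  have := C.comp_mem h hq'
  have h2 : Q C (k := 0) (l := n) Fin.elim0 (fun i => g (w.get i)) := by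
    refine mem_eq this ?_
    unfold comp
    ext x y
    rcases x with x | x
    · exact x.elim0
    rcases y with y | y
    · exact y.elim0
    rw [Setoid.comap_rel, Setoid.ker_def]
    set r := (fun x y : Fin 0 ⊕ (Fin (n+2) ⊕ Fin n) =>
      (∃ a_1 b_1, inSameBlock (Setoid.ker (Sum.elim ([] : List ℕ).get (a :: b :: w).get)) a_1 b_1 ∧
        Sum.map id Sum.inl a_1 = x ∧ Sum.map id Sum.inl b_1 = y) ∨
      (∃ a b, inSameBlock (Setoid.ker (Sum.elim (fun i : Fin (n+2) => i.val - 1)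
        (fun i : Fin n => i.val + 1))) a b ∧ Sum.inr a = x ∧ Sum.inr b = y)) with hr
    change _ ↔ Relation.EqvGen r _ _
    simp only [Sum.elim_inr, Sum.map_inr]
    have mid : ∀ i j : Fin (n+2), (a :: b :: w).get i = (a :: b :: w).get j →
        Relation.EqvGen r (.inr (.inl i)) (.inr (.inl j)) := by
      intro i j hij
      exact .rel _ _ (Or.inl ⟨.inr i, .inr j, hij, rfl, rfl⟩)
    have low : ∀ i : Fin n, Relation.EqvGen r (.inr (.inr i)) (.inr (.inl i.succ.succ)) := by
      intro i
      refine .rel _ _ (Or.inr ⟨.inr i, .inl i.succ.succ, ?_, rfl, rfl⟩)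
      change _ = _
      simp
    have m01 : Relation.EqvGen r (.inr (.inl 0)) (.inr (.inl 1)) := by
      refine .rel _ _ (Or.inr ⟨.inl 0, .inl 1, ?_, rfl, rfl⟩)
      change _ = _
      simp
    constructor
    · intro hxy
      rw [hg _ (by simp) _ (by simp)] at hxy
      have key : ∀ x : Fin n, (w.get x = a ∨ w.get x = b) →
          Relation.EqvGen r (.inr (.inr x)) (.inr (.inl 0)) := by
        rintro x (hx | hx)
        · exact (low x).trans _ _ _ (mid x.succ.succ 0 hx)
        · exact ((low x).trans _ _ _ (mid x.succ.succ 1 hx)).trans _ _ _ (m01.symm)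
      rcases hxy with hxy | ⟨hx, hy⟩
      · exact ((low x).trans _ _ _ (mid x.succ.succ y.succ.succ hxy)).trans _ _ _ (low y).symm
      · exact (key x hx).trans _ _ _ (key y hy).symm
    · intro hxy
      -- labels
      let F : ℕ → ℕ := fun c => if c = b then a else c
      let φ : Fin 0 ⊕ (Fin (n+2) ⊕ Fin n) → ℕ :=
        Sum.elim Fin.elim0 (Sum.elim (fun i => F ((a :: b :: w).get i)) (fun i => F (w.get i)))
      have hφ : ∀ x y, Relation.EqvGen r x y → φ x = φ y := by
        intro x y h
        induction h with
        | refl => rfl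
        | symm _ _ _ ih => exact ih.symm
        | trans _ _ _ _ _ i1 i2 => exact i1.trans i2
        | rel x y h =>
          rcases h with ⟨p, q, h, rfl, rfl⟩ | ⟨p, q, h, rfl, rfl⟩
          · rcases p with p | p
            · exact p.elim0
            rcases q with q | q
            · exact q.elim0
            have h : (a :: b :: w).get p = (a :: b :: w).get q := h
            change F _ = F _
            rw [h]
          · have h : Sum.elim (fun i : Fin (n+2) => i.val - 1) (fun i : Fin n => i.val + 1) p =
              Sum.elim (fun i : Fin (n+2) => i.val - 1) (fun i : Fin n => i.val + 1) q := h
            have lab : ∀ p : Fin (n+2) ⊕ Fin n, φ (Sum.inr p) = F ((b :: w).getD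
              (Sum.elim (fun i : Fin (n+2) => i.val - 1) (fun i : Fin n => i.val + 1) p) 0) := by
              rintro (⟨p, hp⟩ | ⟨p, hp⟩)
              · match p with
                | 0 =>
                  have : F a = F b := by
                    by_cases hab : a = b
                    · rw [hab]
                    · simp [F, hab]
                  exact this
                | 1 => simp [φ]
                | p + 2 =>
                  have : p < w.length := by omega
                  simp [φ, this]
              · have : p < w.length := hp
                simp [φ, this]
            rw [lab, lab, h]
      have := hφ _ _ hxy
      rw [hg _ (by simp) _ (by simp)]
      have : F (w.get x) = F (w.get y) := this
      simp only [F] at this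
      split_ifs at this <;> grind
  refine Q_cast h2 rfl (by simp [n]) (fun i => i.elim0) ?_
  intro i
  simp

end

section
variable {C : PartitionCategory}

theorem exists_fresh (w : List ℕ) : ∃ d, d ∉ w := by
  obtain ⟨d, hd⟩ := Infinite.exists_notMem_finset w.toFinset
  exact ⟨d, by simpa using hd⟩

theorem W_cap_eq {a : ℕ} {w : List ℕ} (h : W C (a :: a :: w)) : W C w := by
  have := W_cap (g := id) h (by grind)
  simpa using this

theorem W_cap' {a b : ℕ} {w : List ℕ} (h : W C (a :: b :: w)) :
    W C (w.map (fun c => if c = b then a else c)) :=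
  W_cap h (by grind)

theorem W_tensor {x y : List ℕ} (hx : W C x) (hy : W C y)
    (hd : ∀ a ∈ x, ∀ b ∈ y, a ≠ b) : W C (x ++ y) :=
  P2_tensor (u := []) (u' := []) hx hy (by simpa using hd)

theorem W_triple (h4 : W C [0, 0, 0, 0]) {a : ℕ} {w : List ℕ} (h : W C (a :: w)) :
    W C (a :: a :: a :: w) := by
  obtain ⟨d, hd⟩ := exists_fresh (a :: w)
  have h4d : W C [d, d, d, d] := W_relabel' (w := [0, 0, 0, 0]) (g := fun _ => d) h4 (by simp)
  have h1 : W C ([d, d, d, d] ++ (a :: w)) := W_tensor h4d h (by grind)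
  have h2 : W C (d :: a :: (w ++ [d, d, d])) := by
    have := W_rot (x := [d, d, d]) (y := d :: a :: w) h1
    simpa using this
  have h3 := W_cap (g := fun c => if c = d then a else c) h2 (by grind)
  have h4 : List.map (fun c => if c = d then a else c) w = w := by
    conv_rhs => rw [← List.map_id w]
    apply List.map_congr_left
    grind
  rw [List.map_append, h4] at h3
  simpa using W_rot h3

theorem W_merge (h4 : W C [0, 0, 0, 0]) {a b : ℕ} {w : List ℕ} (h : W C (a :: b :: w)) :
    W C (a :: a :: w.map (fun c => if c = b then a else c)) := by
  have h1 := W_triple h4 h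
  have h2 : W C (a :: b :: (w ++ [a, a])) := by
    simpa using W_rot (x := [a, a]) (y := a :: b :: w) h1
  have h3 := W_cap' h2
  rw [List.map_append] at h3
  simpa using W_rot h3

theorem W_seg (h4 : W C [0, 0, 0, 0]) (n : ℕ) : ∀ {x : ℕ} {s w : List ℕ}, s.length = n →
    W C ((x :: s) ++ w) →
    W C (List.replicate (n + 1) x ++ w.map (fun c => if c ∈ x :: s then x else c)) := by
  induction n with
  | zero =>
    intro x s w hs h
    have : s = [] := by simpa using hs
    subst this
    have e : List.map (fun c => if c ∈ [x] then x else c) w = w := by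
      conv_rhs => rw [← List.map_id w]
      apply List.map_congr_left
      grind
    rw [e]
    simpa using h
  | succ n ih =>
    intro x s w hs h
    rcases s with _ | ⟨y, s⟩
    · simp at hs
    have h1 := W_merge h4 (a := x) (b := y) (w := s ++ w) (by simpa using h)
    rw [List.map_append] at h1
    set f := (fun c => if c = y then x else c) with hf
    have h2 : W C ((x :: s.map f) ++ (w.map f ++ [x])) := by
      simpa using W_rot (x := [x]) h1
    have h3 := ih (by simpa using hs) h2
    have h4 := W_rot (y := [x]) (by simpa [← List.append_assoc] using h3)
    rw [List.replicate_succ]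
    have e : ∀ c, (if f c = x ∨ ∃ a ∈ s, f a = f c then x else f c) =
      if c = x ∨ c = y ∨ c ∈ s then x else c := by
      intro c
      simp only [hf]
      grind
    have h5 : W C (x :: (List.replicate (n + 1) x ++
      w.map (fun c => if c ∈ x :: y :: s then x else c))) := by
      convert h4 using 2
      simp [Function.comp_def, e]
    simpa using h5

theorem W_seg' (h4 : W C [0, 0, 0, 0]) {b : ℕ} {s w : List ℕ} (hb : b ∈ s) (h : W C (s ++ w)) :
    W C (List.replicate s.length b ++ w.map (fun c => if c ∈ s then b else c)) := by
  rcases s with _ | ⟨x, s⟩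
  · simp at hb
  have h1 := W_seg h4 s.length rfl h
  have h2 : W C ((List.replicate (s.length + 1) x ++ w).map
      (fun c => if c ∈ x :: s then x else c)) := by
    rw [List.map_append]; simpa using h1
  have h3 := W_relabel (g := fun c => if c ∈ x :: s then b else c) h2 (by
    intro c hc d hd; grind)
  rw [List.map_append] at h3
  simpa using h3

/-- Folding: from `u v` get the word u followed by a reversed copy of u, with the letters of `v` identified. -/
theorem W_fold_aux (u v : List ℕ) : ∀ (A : List ℕ),
    W C ((u ++ v).map (fun c => 2 * c) ++
      ((u ++ v).map (fun c => if c ∈ A then 2 * c else 2 * c + 1)).reverse) →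
    W C (u.map (fun c => 2 * c) ++
      (u.map (fun c => if c ∈ A ∨ c ∈ v then 2 * c else 2 * c + 1)).reverse) := by
  induction v using List.reverseRecOn with
  | nil => intro A h; simpa using h
  | append_singleton v d ih =>
    intro A h
    set s := (fun c => if c ∈ A then 2 * c else 2 * c + 1) with hs
    have h1 : W C ((2 * d) :: s d :: (((u ++ v).map s).reverse ++ (u ++ v).map (fun c => 2 * c))) := by
      have := W_rot (x := (u ++ v).map (fun c => 2 * c))
        (y := (2 * d) :: s d :: (((u ++ v).map s).reverse)) (by simpa using h)
      simpa using this
    have h2 := W_rot (by simpa only [List.map_append] using W_cap' h1)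
    have h3 := ih (d :: A) (by
      convert h2 using 2
      · simp only [List.map_append, List.map_map]
        congr 1 <;> apply List.map_congr_left <;> intro c hc <;> simp only [hs, Function.comp] <;> grind
      · rw [← List.map_append, List.map_reverse, List.map_map]
        congr 1
        apply List.map_congr_left; intro c hc; simp only [hs, Function.comp]; grind)
    convert h3 using 3
    apply List.map_congr_left; intro c hc; grind

theorem W_fold {u v : List ℕ} (h : W C (u ++ v)) :
    W C (u.map (fun c => 2 * c) ++
      (u.map (fun c => if c ∈ v then 2 * c else 2 * c + 1)).reverse) := by
  have h1 : W C ((u ++ v).map (fun c => 2 * c)) := W_relabel' h (by grind)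
  have h2 : W C ((u ++ v).map (fun c => 2 * c + 1)) := W_relabel' h (by grind)
  have h3 := W_tensor h1 (W_rev h2) (by
    intro a ha b hb
    rw [List.mem_reverse] at hb
    rw [List.mem_map] at ha hb
    grind)
  have := W_fold_aux (C := C) u v [] (by simpa using h3)
  simpa using this

theorem W_replicate_two {b : ℕ} {w : List ℕ} (k : ℕ)
    (h : W C (List.replicate (2 * (k + 1)) b ++ w)) : W C (b :: b :: w) := by
  induction k with
  | zero => simpa using h
  | succ k ih => exact ih (W_cap_eq (a := b) h)

end
section
variable {C : PartitionCategory}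

theorem map_eq_self' {f : ℕ → ℕ} {l : List ℕ} (h : ∀ c ∈ l, f c = c) : l.map f = l := by
  conv_rhs => rw [← List.map_id l]
  exact List.map_congr_left h

theorem exists_first {a : ℕ} {w : List ℕ} (h : a ∈ w) :
    ∃ X v, w = X ++ a :: v ∧ a ∉ X := by
  obtain ⟨X, v, h1, h2⟩ := List.eq_append_cons_of_mem h
  exact ⟨X, v, h1, h2⟩

theorem fat_of_pow (h4 : W C [0, 0, 0, 0]) {α β k : ℕ} (hne : α ≠ β)
    (h : W C (List.replicate (k + 1) β ++ ([α, α] ++ (List.replicate (k + 1) β ++ [α, α])))) :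
    W C [0, 0, 1, 1, 0, 0, 1, 1] := by
  have h1 := W_fold (u := List.replicate (k + 1) β ++ ([α, α] ++ List.replicate (k + 1) β))
    (v := [α, α]) (by simpa only [List.append_assoc] using h)
  have h2 : W C ((List.replicate (k + 1) (2 * β) ++ List.replicate (k + 1) (2 * β + 1)) ++
      ([2 * α, 2 * α] ++ (List.replicate (k + 1) (2 * β + 1) ++
        (List.replicate (k + 1) (2 * β) ++ [2 * α, 2 * α])))) := by
    have := W_rot (x := List.replicate (k + 1) (2 * β) ++ [2 * α, 2 * α])
      (y := (List.replicate (k + 1) (2 * β) ++ List.replicate (k + 1) (2 * β + 1)) ++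
      ([2 * α, 2 * α] ++ List.replicate (k + 1) (2 * β + 1))) (by
      simpa [hne, hne.symm, List.map_replicate, List.reverse_replicate] using h1)
    simpa using this
  have h3 := W_seg' h4 (b := 2 * β) (by simp) h2
  have h5 : W C (List.replicate (2 * (k + 1)) (2 * β) ++ ([2 * α, 2 * α] ++
      (List.replicate (2 * (k + 1)) (2 * β) ++ [2 * α, 2 * α]))) := by
    have e1 : ¬ (α = β) := hne
    have e2 : ¬ (2 * α = 2 * β + 1) := by omega
    have e3 : List.replicate (2 * (k + 1)) (2 * β) =
      List.replicate (k + 1) (2 * β) ++ List.replicate (k + 1) (2 * β) := by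
      rw [List.replicate_append_replicate]; congr 1; omega
    rw [e3]
    have := h3
    rw [List.length_append, List.length_replicate, List.length_replicate,
      ← List.replicate_append_replicate] at this
    simpa [e1, e2, List.map_replicate, -List.replicate_append_replicate] using this
  have h6 := W_replicate_two k h5
  have h7 := W_rot (x := [2 * β, 2 * β, 2 * α, 2 * α]) (by simpa using h6)
  have h8 := W_replicate_two k (w := [2 * α, 2 * α, 2 * β, 2 * β, 2 * α, 2 * α])
    (by simpa using h7)
  have h9 := W_relabel' (g := fun c => if c = 2 * β then 0 else 1) h8 (by
    intro c hc d hd; simp at hc hd; grind)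
  simpa [hne] using h9

theorem fat_of_cross (h4 : W C [0, 0, 0, 0]) {a b : ℕ} {X v : List ℕ}
    (h : W C (a :: X ++ a :: v)) (ha : a ∉ X) (hbX : b ∈ X) (hbv : b ∈ v) :
    W C [0, 0, 1, 1, 0, 0, 1, 1] := by
  have h1 := W_fold (u := a :: (X ++ [a])) (v := v) (by simpa using h)
  set S : ℕ → ℕ := (fun c => if c ∈ v then 2 * c else 2 * c + 1) with hS
  have hSa : S a = 2 * a ∨ S a = 2 * a + 1 := by simp only [hS]; grind
  have hE : ∀ c ∈ X.map (fun c => 2 * c), c ≠ 2 * a ∧ c ≠ S a := by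
    intro c hc; rw [List.mem_map] at hc; grind
  have hSX : ∀ c ∈ (X.map S).reverse, c ≠ 2 * a ∧ c ≠ S a := by
    intro c hc; rw [List.mem_reverse, List.mem_map] at hc; grind
  have hSb : S b = 2 * b := by simp [hS, hbv]
  have hbS : 2 * b ∈ (X.map S).reverse := by
    rw [List.mem_reverse, List.mem_map]; exact ⟨b, hbX, hSb⟩
  have hlen : (X.map S).reverse.length = X.length := by simp
  have hbE : 2 * b ∈ X.map (fun c => 2 * c) := List.mem_map.2 ⟨b, hbX, rfl⟩
  have hlenE : (X.map (fun c => 2 * c)).length = X.length := by simp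
  have h1' : W C ((2 * a :: X.map (fun c => 2 * c)) ++ ([2 * a, S a] ++ ((X.map S).reverse ++ [S a]))) := by
    simpa using h1
  clear h1
  generalize X.map (fun c => 2 * c) = E at *
  generalize (X.map S).reverse = R at *
  have h2 := W_seg' h4 (b := 2 * a) (by simp)
    (show W C ([2 * a, S a] ++ (R ++ (S a :: 2 * a :: E))) by simpa using W_rot h1')
  rw [List.map_append, List.map_cons, List.map_cons, map_eq_self' (l := R) (by grind),
    map_eq_self' (l := E) (by grind)] at h2
  have h3 : W C (E ++ ([2 * a, 2 * a] ++ (R ++ [2 * a, 2 * a]))) := by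
    have := W_rot (x := [2 * a, 2 * a] ++ (R ++ [2 * a, 2 * a])) (y := E) (by simpa using h2)
    simpa using this
  have h5 := W_seg' h4 hbE h3
  have hEa : 2 * a ∉ E := fun h => (hE _ h).1 rfl
  rw [List.map_append, List.map_append, map_eq_self' (l := [2 * a, 2 * a]) (by grind)] at h5
  set R' := R.map (fun c => if c ∈ E then 2 * b else c) with hR'
  have hR'a : 2 * a ∉ R' := by rw [hR', List.mem_map]; grind
  have hR'b : 2 * b ∈ R' := by rw [hR', List.mem_map]; exact ⟨2 * b, hbS, by simp⟩
  have hR'l : R'.length = X.length := by rw [hR', List.length_map, hlen]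
  have h6 := W_rot (x := List.replicate E.length (2 * b) ++ [2 * a, 2 * a])
    (by simpa only [List.append_assoc] using h5)
  have h7 := W_seg' h4 hR'b (by simpa only [List.append_assoc] using h6)
  rw [List.map_append, List.map_append, map_eq_self' (l := [2 * a, 2 * a]) (by grind),
    map_eq_self' (l := List.replicate _ _) (by grind), hR'l, hlenE] at h7
  obtain ⟨k, hk⟩ : ∃ k, X.length = k + 1 := by
    rcases X with _ | ⟨x, X⟩
    · simp at hbX
    · exact ⟨_, rfl⟩
  rw [hk] at h7
  refine fat_of_pow h4 (α := 2 * a) (β := 2 * b) (k := k) ?_ h7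
  intro h
  exact hEa (h ▸ hbE)

theorem double_of_single (n : ℕ) : ∀ {a : ℕ} {v : List ℕ}, v.length = n → W C (a :: v) → a ∉ v →
    W C [0, 1] := by
  induction n using Nat.strong_induction_on with
  | _ n ih =>
    intro a v hn h hav
    match v, hn, h, hav with
    | [], hn, h, hav =>
      have h0 : W C [0] := W_relabel' (g := fun _ => 0) h (by simp)
      have h1 : W C [1] := W_relabel' (g := fun _ => 1) h (by simp)
      exact W_tensor h0 h1 (by simp)
    | [c], hn, h, hav =>
      have := W_relabel' (g := fun x => if x = a then 0 else 1) h (by grind)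
      have hca : c ≠ a := by grind
      simpa [hca] using this
    | c :: d :: v, hn, h, hav =>
      have h1 : W C (c :: d :: (v ++ [a])) := by simpa using W_rot (x := [a]) h
      have h2 := W_cap' h1
      rw [List.map_append] at h2
      have h3 := W_rot h2
      have hda : a ≠ d := by grind
      refine ih v.length (by simp at hn; omega) (a := a)
        (v := v.map (fun x => if x = d then c else x)) (by simp) (by simpa [hda] using h3) ?_
      rw [List.mem_map]
      grind

theorem split_right (hs : ¬ W C [0, 1]) (n : ℕ) : ∀ {u v : List ℕ}, u.length = n → W C (u ++ v) →
    (∀ c ∈ u, c ∉ v) → W C v := by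
  induction n using Nat.strong_induction_on with
  | _ n ih =>
    intro u v hn h hd
    match u, hn, h, hd with
    | [], hn, h, hd => simpa using h
    | [c], hn, h, hd => exact absurd (double_of_single _ rfl h (hd c (by simp))) hs
    | c :: d :: u, hn, h, hd =>
      have h2 := W_cap' (w := u ++ v) h
      rw [List.map_append, map_eq_self' (l := v) (by grind)] at h2
      refine ih u.length (by simp at hn; omega) (by simp) h2 ?_
      intro x hx
      rw [List.mem_map] at hx
      grind

theorem W_subset {D : PartitionCategory} (h4 : W C [0, 0, 0, 0]) (h4D : W D [0, 0, 0, 0])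
    (hs : ¬ W C [0, 1]) (hF : ¬ W C [0, 0, 1, 1, 0, 0, 1, 1]) (n : ℕ) :
    ∀ {w : List ℕ}, w.length = n → W C w → W D w := by
  induction n using Nat.strong_induction_on with
  | _ n ih =>
    intro w hn h
    have key : ∀ {a : ℕ} {X v : List ℕ}, (a :: X ++ a :: v).length = n → W C (a :: X ++ a :: v) →
        a ∉ X → X ≠ [] → W D (a :: X ++ a :: v) := by
      intro a X v hn h ha hX
      have hd : ∀ c ∈ X, c ∉ v := fun c hc hv => hF (fat_of_cross h4 h ha hc hv)
      have hd' : ∀ c ∈ X, c ∉ a :: v ++ [a] := by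
        intro c hc; have := hd c hc; simp; grind
      have h1 : W C (X ++ (a :: v ++ [a])) := by simpa using W_rot (x := [a]) h
      have hXpos : 0 < X.length := List.length_pos_iff.2 hX
      have h2 : W C (a :: v ++ [a]) := split_right hs _ rfl h1 hd'
      have h3 : W C X := split_right hs _ rfl (W_rot h1) (fun c hc hX => hd' c hX hc)
      have d2 := ih _ (by simp at hn ⊢; omega) rfl h2
      have d3 := ih _ (by simp at hn ⊢; omega) rfl h3
      have d := W_tensor d3 d2 (by intro c hc b hb e; subst e; exact hd' _ hc hb)
      have := W_rot (x := X ++ a :: v) (y := [a]) (by simpa using d)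
      simpa using this
    rcases w with _ | ⟨a, w⟩
    · exact W_nil
    have haw : a ∈ w := by
      by_contra hc
      exact hs (double_of_single _ rfl h hc)
    obtain ⟨X, v, rfl, haX⟩ := exists_first haw
    by_cases hX : X ≠ []
    · exact key hn h haX hX
    rw [not_not] at hX
    subst hX
    by_cases hav : a ∈ v
    · obtain ⟨y, z, rfl, hay⟩ := exists_first hav
      by_cases hy : y ≠ []
      · have h1 : W C (a :: y ++ a :: (z ++ [a])) := by simpa using W_rot (x := [a]) h
        have h2 := key (by simp at hn ⊢; omega) h1 hay hy
        simpa using W_rot (x := a :: y ++ a :: z) (y := [a]) (by simpa using h2)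
      · rw [not_not] at hy
        subst hy
        have h1 : W C (a :: z) := W_cap_eq (a := a) (by simpa using h)
        have := ih _ (by simp at hn ⊢; omega) rfl h1
        simpa using W_triple h4D this
    · have h1 : W C v := W_cap_eq (a := a) (by simpa using h)
      have d1 := ih _ (by simp at hn ⊢; omega) rfl h1
      have d2 : W D [a, a] := P2_rotUL (P2_id a)
      exact W_tensor d2 d1 (by grind)

end

theorem exists_labels {k l : ℕ} (p : Partition k l) :
    ∃ up lo : List ℕ, ∀ C : PartitionCategory,
      (⟨k, l, p⟩ : Σ k l : ℕ, Partition k l) ∈ C.mem ↔ P2 C up lo := by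
  obtain ⟨e, he⟩ := exists_injective_nat (Quotient p)
  let f : Fin k ⊕ Fin l → ℕ := fun x => e (Quotient.mk p x)
  have hf : p = Setoid.ker (Sum.elim (f ∘ Sum.inl) (f ∘ Sum.inr)) := by
    ext x y
    rw [Setoid.ker_def, Sum.elim_comp_inl_inr]
    simp only [f, he.eq_iff]
    exact Quotient.eq.symm
  refine ⟨List.ofFn (f ∘ Sum.inl), List.ofFn (f ∘ Sum.inr), fun C => ?_⟩
  constructor
  · intro h
    have h1 : Q C (f ∘ Sum.inl) (f ∘ Sum.inr) := mem_eq h hf.symm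
    exact Q_cast h1 (by simp) (by simp) (by simp) (by simp)
  · intro h
    have h1 : Q C (f ∘ Sum.inl) (f ∘ Sum.inr) :=
      Q_cast h (by simp) (by simp) (fun i => by simp; rfl) (fun i => by simp; rfl)
    exact mem_eq h1 hf

theorem W_four {C : PartitionCategory}
    (h : (⟨0, 4, fourBlock⟩ : Σ k l : ℕ, Partition k l) ∈ C.mem) : W C [0, 0, 0, 0] := by
  refine mem_eq h ?_
  ext x y
  rw [Setoid.ker_def]
  change _ ↔ True
  rcases x with x | x
  · exact x.elim0
  rcases y with y | y
  · exact y.elim0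
  revert x y
  decide

theorem mem_double {C : PartitionCategory} (h : W C [0, 1]) :
    (⟨0, 2, doubleSingleton⟩ : Σ k l : ℕ, Partition k l) ∈ C.mem := by
  refine mem_eq h ?_
  ext x y
  rw [Setoid.ker_def]
  change x = y ↔ _
  rcases x with x | x
  · exact x.elim0
  rcases y with y | y
  · exact y.elim0
  revert x y
  decide

theorem mem_fat {C : PartitionCategory} (h : W C [0, 0, 1, 1, 0, 0, 1, 1]) :
    (⟨4, 4, fatCross⟩ : Σ k l : ℕ, Partition k l) ∈ C.mem := by
  have h1 : P2 C [1, 1, 0, 0] [0, 0, 1, 1] := P2_word.2 (by simpa using h)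
  refine mem_eq h1 ?_
  ext x y
  rw [Setoid.ker_def]
  unfold fatCross
  rw [Setoid.ker_def]
  revert x y
  decide

theorem statement8 (C : PartitionCategory) (hH : Hyperoctahedral C)
    (hne : C.mem ≠ generated {(⟨0, 4, fourBlock⟩ : Σ k l : ℕ, Partition k l)}) :
    (⟨4, 4, fatCross⟩ : Σ k l : ℕ, Partition k l) ∈ C.mem := by
  by_contra hF
  apply hne
  ext ⟨k, l, p⟩
  constructor
  · intro hp D hD
    have h4D := W_four (hD (Set.mem_singleton _))
    obtain ⟨up, lo, H⟩ := exists_labels p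
    rw [H, P2_word] at hp ⊢
    exact W_subset (W_four hH.1) h4D (fun h => hH.2 (mem_double h))
      (fun h => hF (mem_fat h)) _ rfl hp
  · intro hp
    exact hp C (by
      rintro x hx
      rw [Set.mem_singleton_iff] at hx
      rw [hx]
      exact hH.1)

end EasyQG
end

section
/- (Doubling Lemma) Let C be a non group-theoretical hyperoctahedral category of partitions, and let p ∈ C ∩ P(0,n) be of the form p = X₁ a X₂ a X₃ as a word, for a letter a and subwords X₁, X₂, X₃. Then: (a) every letter b ≠ a that appears in X₂ appears an even number of times in X₂; (b) if X₂ has odd length, it contains the letter a; (c) if X₂ has even length at least two, it contains two consecutive equal letters, i.e. X₂ = Y₁ b b Y₂ for some letter b (possibly b = a). -/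
namespace EasyQG

/-- Membership of the two-row partition labelled by an upper and a lower word. -/
def TT (C : PartitionCategory) (u v : List ℕ) : Prop :=
  (⟨u.length, v.length, Setoid.ker (Sum.elim u.get v.get)⟩ :
    Σ k l : ℕ, Partition k l) ∈ C.mem

theorem TT_of (C : PartitionCategory) {k l : ℕ} {u v : List ℕ} (f : Fin k → ℕ) (g : Fin l → ℕ)
    (hk : k = u.length) (hl : l = v.length)
    (hf : ∀ i : Fin k, u[i.val]? = some (f i)) (hg : ∀ i : Fin l, v[i.val]? = some (g i))
    (h : (⟨k, l, Setoid.ker (Sum.elim f g)⟩ : Σ k l : ℕ, Partition k l) ∈ C.mem) :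
    TT C u v := by
  subst hk hl
  have h1 : f = u.get := by
    funext i
    have := hf i
    simp at this
    simp [this]
  have h2 : g = v.get := by
    funext i
    have := hg i
    simp at this
    simp [this]
  subst h1 h2
  exact h

theorem ker_comap {α β γ : Type*} (F : β → γ) (G : α → β) :
    Setoid.comap G (Setoid.ker F) = Setoid.ker (F ∘ G) := by
  ext x y
  simp [Setoid.comap_rel, Setoid.ker_def]

theorem TT_LU {C : PartitionCategory} {u v : List ℕ} {x : ℕ} (h : TT C u (x :: v)) :
    TT C (x :: u) v := by
  have h' := C.rotLU_mem (k := u.length) (l := v.length) h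
  suffices e : @rotLU u.length v.length (Setoid.ker (Sum.elim u.get (x :: v).get)) =
      Setoid.ker (Sum.elim (x :: u).get v.get) by
    rw [e] at h'
    exact h'
  unfold rotLU
  rw [ker_comap]
  congr 1
  funext i
  rcases i with i | j
  · refine Fin.cases ?_ (fun i => ?_) i <;> simp
  · simp

theorem TT_UL {C : PartitionCategory} {u v : List ℕ} {x : ℕ} (h : TT C (x :: u) v) :
    TT C u (x :: v) := by
  have h' := C.rotUL_mem (k := u.length) (l := v.length) h
  suffices e : @rotUL u.length v.length (Setoid.ker (Sum.elim (x :: u).get v.get)) =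
      Setoid.ker (Sum.elim u.get (x :: v).get) by
    rw [e] at h'
    exact h'
  unfold rotUL
  rw [ker_comap]
  congr 1
  funext i
  rcases i with i | j
  · simp
  · refine Fin.cases ?_ (fun i => ?_) j <;> simp

theorem TT_rot1 {C : PartitionCategory} {v : List ℕ} {x : ℕ} (h : TT C [] (x :: v)) :
    TT C [] (v ++ [x]) := by
  have h' := C.rotUR_mem (k := 0) (l := v.length) (TT_LU h)
  unfold rotUR at h'
  rw [ker_comap] at h'
  refine TT_of C (k := 0) (l := v.length + 1) Fin.elim0
    (fun j => Fin.lastCases x (fun j' => v.get j') j) rfl (by simp) (fun i => i.elim0) ?_ ?_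
  · intro i
    refine Fin.lastCases ?_ (fun i => ?_) i <;> simp
  · convert h' using 3
    congr 1
    funext i
    rcases i with i | j
    · exact i.elim0
    · refine Fin.lastCases ?_ (fun i => ?_) j <;> simp

theorem TT_rot {C : PartitionCategory} {u v : List ℕ} (h : TT C [] (u ++ v)) :
    TT C [] (v ++ u) := by
  induction u generalizing v with
  | nil => simpa using h
  | cons x u ih =>
    have := TT_rot1 (x := x) (v := u ++ v) (by simpa using h)
    have := ih (v := v ++ [x]) (by simpa using this)
    simpa using this

theorem top22 {C : PartitionCategory} (hH : Hyperoctahedral C) :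
    (⟨2, 2, ⊤⟩ : Σ k l : ℕ, Partition k l) ∈ C.mem :=
  C.rotLU_mem (k := 1) (l := 2) (C.rotLU_mem (k := 0) (l := 3) hH.1)

theorem top02 (C : PartitionCategory) :
    (⟨0, 2, ⊤⟩ : Σ k l : ℕ, Partition k l) ∈ C.mem :=
  C.rotUL_mem (k := 0) (l := 1) C.id_mem

/-- The generating relation of a composition. -/
theorem comp_eq_ker {k l m : ℕ} (p : Partition k l) (q : Partition l m)
    (H : Fin k ⊕ (Fin l ⊕ Fin m) → ℕ)
    (hp : ∀ a b, p a b → H (Sum.map id Sum.inl a) = H (Sum.map id Sum.inl b))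
    (hq : ∀ a b, q a b → H (Sum.inr a) = H (Sum.inr b))
    (hc : ∀ S : Setoid (Fin k ⊕ (Fin l ⊕ Fin m)),
      (∀ a b, p a b → S (Sum.map id Sum.inl a) (Sum.map id Sum.inl b)) →
      (∀ a b, q a b → S (Sum.inr a) (Sum.inr b)) →
      ∀ a b : Fin k ⊕ Fin m, H (Sum.map id Sum.inr a) = H (Sum.map id Sum.inr b) →
        S (Sum.map id Sum.inr a) (Sum.map id Sum.inr b)) :
    comp p q = Setoid.ker (fun a : Fin k ⊕ Fin m => H (Sum.map id Sum.inr a)) := by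
  unfold comp
  apply le_antisymm
  · intro a b h
    rw [Setoid.comap_rel] at h
    have key : ∀ x y, Relation.EqvGen (fun x y : Fin k ⊕ (Fin l ⊕ Fin m) =>
      (∃ a b, inSameBlock p a b ∧ Sum.map id Sum.inl a = x ∧ Sum.map id Sum.inl b = y) ∨
      (∃ a b, inSameBlock q a b ∧ Sum.inr a = x ∧ Sum.inr b = y)) x y → H x = H y := by
      intro x y h
      induction h with
      | rel x y h =>
        rcases h with ⟨a, b, h, rfl, rfl⟩ | ⟨a, b, h, rfl, rfl⟩
        · exact hp a b h
        · exact hq a b h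
      | refl => rfl
      | symm x y _ ih => exact ih.symm
      | trans x y z _ _ h1 h2 => exact h1.trans h2
    exact key _ _ h
  · intro a b h
    rw [Setoid.comap_rel]
    refine hc _ ?_ ?_ a b h
    · intro a b h
      exact Relation.EqvGen.rel _ _ (Or.inl ⟨a, b, h, rfl, rfl⟩)
    · intro a b h
      exact Relation.EqvGen.rel _ _ (Or.inr ⟨a, b, h, rfl, rfl⟩)

/-- Replace the letter `y` by `x`. -/
def sb (x y z : ℕ) : ℕ := if z = y then x else z

theorem TT_merge {C : PartitionCategory} (hH : Hyperoctahedral C) {x y : ℕ} {v : List ℕ}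
    (h : TT C [] (x :: y :: v)) : TT C [] (x :: x :: v.map (sb x y)) := by
  have h1 := TT_LU (TT_LU h)
  have h2 := C.comp_mem (top22 hH) h1
  rw [comp_eq_ker (k := 2) (l := 2) (m := v.length) _ _
    (Sum.elim (fun _ => x) (Sum.elim (fun _ => x) (fun j => sb x y (v.get j))))] at h2
  · refine TT_UL (TT_UL (TT_of C (k := 2) (l := v.length) (fun _ => x)
      (fun j => sb x y (v.get j)) rfl (by simp) ?_ ?_ ?_))
    · intro i; fin_cases i <;> rfl
    · intro i; simp
    · convert h2 using 3
      congr 1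
      funext i
      rcases i with i | i <;> rfl
  · intro a b _
    rcases a with a | a <;> rcases b with b | b <;> rfl
  · have : ∀ a : Fin 2 ⊕ Fin v.length, (Sum.elim (fun _ => x)
        (Sum.elim (fun _ => x) (fun j => sb x y (v.get j))) :
        Fin 2 ⊕ (Fin 2 ⊕ Fin v.length) → ℕ) (Sum.inr a) =
        sb x y (Sum.elim (List.get [y, x]) v.get a) := by
      intro a
      rcases a with a | a
      · fin_cases a <;> simp [sb]
      · rfl
    intro a b hab
    rw [this, this]
    exact congrArg _ hab
  · intro S hp hq
    have key : ∀ a : Fin 2 ⊕ Fin v.length,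
        (Sum.elim (fun _ => x) (fun j => sb x y (v.get j)) a = x) →
        S (Sum.map id Sum.inr a) (Sum.inr (Sum.inl (0 : Fin 2))) := by
      intro a ha
      rcases a with a | j
      · exact hp (Sum.inl a) (Sum.inr 0) trivial
      · simp only [Sum.elim_inr, sb] at ha
        split_ifs at ha with hy
        · exact hq (Sum.inr j) (Sum.inl 0) (by simpa [Setoid.ker_def] using hy)
        · have e1 := hq (Sum.inr j) (Sum.inl 1) (by simpa [Setoid.ker_def] using ha)
          exact S.trans e1 (hp (Sum.inr 1) (Sum.inr 0) trivial)
    intro a b hab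
    have e : ∀ a : Fin 2 ⊕ Fin v.length, (Sum.elim (fun _ => x)
        (Sum.elim (fun _ => x) (fun j => sb x y (v.get j))) :
        Fin 2 ⊕ (Fin 2 ⊕ Fin v.length) → ℕ) (Sum.map id Sum.inr a) =
        Sum.elim (fun _ => x) (fun j => sb x y (v.get j)) a := by
      intro a
      rcases a with a | a <;> rfl
    rw [e, e] at hab
    by_cases hx : Sum.elim (fun _ => x) (fun j => sb x y (v.get j)) a = x
    · exact S.trans (key a hx) (S.symm (key b (hab ▸ hx)))
    · rcases a with a | i
      · exact absurd rfl hx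
      · rcases b with b | j
        · exact absurd hab hx
        · refine hq (Sum.inr i) (Sum.inr j) ?_
          simp only [Sum.elim_inr, sb] at hab hx
          simp only [Setoid.ker_def, Sum.elim_inr]
          grind

theorem TT_del {C : PartitionCategory} {x : ℕ} {v : List ℕ}
    (h : TT C [] (x :: x :: v)) : TT C [] v := by
  have h1 := TT_LU (TT_LU h)
  have h2 := C.comp_mem (top02 C) h1
  rw [comp_eq_ker (k := 0) (l := 2) (m := v.length) _ _
    (Sum.elim Fin.elim0 (Sum.elim (fun _ => x) v.get))] at h2
  · refine TT_of C (k := 0) (l := v.length) Fin.elim0 v.get rfl rfl (fun i => i.elim0) ?_ ?_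
    · intro i; simp
    · convert h2 using 3
      congr 1
      funext i
      rcases i with i | i
      · exact i.elim0
      · rfl
  · intro a b _
    rcases a with a | a
    · exact a.elim0
    rcases b with b | b
    · exact b.elim0
    rfl
  · have : ∀ a : Fin 2 ⊕ Fin v.length, (Sum.elim Fin.elim0
        (Sum.elim (fun _ => x) v.get) :
        Fin 0 ⊕ (Fin 2 ⊕ Fin v.length) → ℕ) (Sum.inr a) =
        (Sum.elim (List.get [x, x]) v.get a) := by
      intro a
      rcases a with a | a
      · fin_cases a <;> simp
      · rfl
    intro a b hab
    rw [this, this]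
    exact hab
  · intro S hp hq a b hab
    rcases a with a | a
    · exact a.elim0
    rcases b with b | b
    · exact b.elim0
    exact hq (Sum.inr a) (Sum.inr b) hab

/-- Labels of the lower row in `q* q`. -/
def tau (Y : List ℕ) (z : ℕ) : ℕ := if z ∈ Y then 2 * z else 2 * z + 1

theorem TT_double {C : PartitionCategory} {u Y : List ℕ} (h : TT C u Y) :
    TT C (u.map (fun z => 2 * z)) (u.map (tau Y)) := by
  have h2 := C.comp_mem h (C.involution_mem h)
  unfold involution at h2
  rw [ker_comap, comp_eq_ker (k := u.length) (l := Y.length) (m := u.length) _ _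
    (Sum.elim (fun i => 2 * u.get i) (Sum.elim (fun i => 2 * Y.get i)
      (fun i => tau Y (u.get i))))] at h2
  · refine TT_of C (k := u.length) (l := u.length) (fun i => 2 * u.get i)
      (fun i => tau Y (u.get i)) (by simp) (by simp) (by simp) (by simp) ?_
    convert h2 using 3
    congr 1
    funext i
    rcases i with i | i <;> rfl
  · intro a b hab
    rcases a with a | a <;> rcases b with b | b <;>
      simpa [Setoid.ker_def] using hab
  · have e1 : ∀ i : Fin Y.length, Y[(i : ℕ)] ∈ Y := fun i => List.getElem_mem _
    intro a b hab
    rcases a with a | a <;> rcases b with b | b <;>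
      simp [Setoid.ker_def] at hab ⊢
    · exact hab
    · have := e1 a; rw [hab] at this; simp [tau, this, hab]
    · have := e1 b; rw [← hab] at this; simp [tau, this, ← hab]
    · rw [hab]
  · intro S hp hq
    have key : ∀ i j : Fin u.length, 2 * u.get i = tau Y (u.get j) →
        S (Sum.inl i) (Sum.inr (Sum.inr j)) := by
      intro i j hij
      unfold tau at hij
      split_ifs at hij with hm
      · obtain ⟨t, ht⟩ := List.mem_iff_get.1 hm
        refine S.trans (hp (Sum.inl i) (Sum.inr t) ?_) (hq (Sum.inl t) (Sum.inr j) ?_)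
        · simp only [Setoid.ker_def, Sum.elim_inl, Sum.elim_inr]; omega
        · simp only [Setoid.ker_def, Function.comp, Sum.swap, Sum.elim_inl, Sum.elim_inr]; omega
      · omega
    intro a b hab
    rcases a with a | a <;> rcases b with b | b <;>
      simp only [Sum.map_inl, Sum.map_inr, Sum.elim_inl, Sum.elim_inr, id] at hab ⊢
    · exact hp (Sum.inl a) (Sum.inl b) (by simp only [Setoid.ker_def, Sum.elim_inl]; omega)
    · exact key a b hab
    · exact S.symm (key b a hab.symm)
    · refine hq (Sum.inr a) (Sum.inr b) ?_
      change u.get a = u.get b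
      unfold tau at hab
      split_ifs at hab <;> omega

theorem final_step {C : PartitionCategory} (hH : Hyperoctahedral C) (hG : ¬ GroupTheoretical C)
    {a b : ℕ} {Y : List ℕ} (hab : a ≠ b) (h : TT C [] (a :: b :: a :: Y)) : False := by
  have h1 := TT_double (TT_LU (TT_LU (TT_LU h)))
  simp only [List.map] at h1
  have h2 := TT_UL (TT_UL (TT_UL h1))
  have h3 := TT_rot (u := [2 * a, 2 * b]) (v := [2 * a, tau Y a, tau Y b, tau Y a]) h2
  have h4 := TT_merge hH h3
  have hA : tau Y a = 2 * a ∨ tau Y a = 2 * a + 1 := by unfold tau; split_ifs <;> simp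
  have e1 : sb (2 * a) (tau Y a) (2 * a) = 2 * a := by unfold sb; split_ifs <;> omega
  have e2 : sb (2 * a) (tau Y a) (tau Y a) = 2 * a := by simp [sb]
  have e3 : sb (2 * a) (tau Y a) (2 * b) = 2 * b := by unfold sb; split_ifs <;> omega
  have e4 : sb (2 * a) (tau Y a) (tau Y b) = tau Y b := by
    have hB : tau Y b = 2 * b ∨ tau Y b = 2 * b + 1 := by unfold tau; split_ifs <;> simp
    unfold sb; split_ifs <;> omega
  simp only [List.append_eq, List.cons_append, List.nil_append, List.map_cons, List.map_nil, e1, e2, e3, e4] at h4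
  by_cases hb : b ∈ Y
  · have e5 : tau Y b = 2 * b := by simp [tau, hb]
    rw [e5] at h4
    -- a a b a a b
    have h5 := TT_rot (u := [2 * a, 2 * a]) h4
    have h6 := TT_LU (TT_LU (TT_LU h5))
    apply hG
    unfold GroupTheoretical
    suffices e : pairPositioner = @Setoid.ker (Fin 3 ⊕ Fin 3) ℕ
        (Sum.elim (List.get [2 * a, 2 * a, 2 * b]) (List.get [2 * b, 2 * a, 2 * a])) by
      rw [e]
      exact h6
    unfold pairPositioner
    ext s t
    rw [Setoid.ker_def, Setoid.ker_def]
    rcases s with s | s <;> rcases t with t | t <;> fin_cases s <;> fin_cases t <;>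
      simp [hab, hab.symm]
  · have e5 : tau Y b = 2 * b + 1 := by simp [tau, hb]
    rw [e5] at h4
    have h5 := TT_del h4
    have h6 := TT_rot (u := [2 * b + 1]) h5
    have h7 := TT_del h6
    apply hH.2
    suffices e : doubleSingleton = @Setoid.ker (Fin 0 ⊕ Fin 2) ℕ
        (Sum.elim (List.get []) (List.get [2 * b, 2 * b + 1])) by
      rw [e]
      exact h7
    unfold doubleSingleton
    ext s t
    rw [Setoid.ker_def]
    rcases s with s | s
    · exact s.elim0
    rcases t with t | t
    · exact t.elim0
    fin_cases s <;> fin_cases t <;> simp <;> first | rfl | omega | skip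

theorem dup_split (X : List ℕ) (h : ¬ X.Nodup) : ∃ (P : List ℕ) (x : ℕ) (Z Q : List ℕ),
    X = P ++ x :: Z ++ x :: Q ∧ Z.Nodup ∧ x ∉ Z := by
  induction X with
  | nil => simp at h
  | cons c X ih =>
    by_cases hX : X.Nodup
    · have hc : c ∈ X := by
        by_contra hc; exact h (List.nodup_cons.2 ⟨hc, hX⟩)
      obtain ⟨Z, Q, rfl⟩ := List.append_of_mem hc
      refine ⟨[], c, Z, Q, by simp, ?_, ?_⟩
      · exact hX.of_append_left
      · intro hz
        exact (List.disjoint_of_nodup_append hX) hz (by simp)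
    · obtain ⟨P, x, Z, Q, rfl, h1, h2⟩ := ih hX
      exact ⟨c :: P, x, Z, Q, by simp, h1, h2⟩

theorem count_sb {x y b : ℕ} (hx : x ≠ b) (hy : y ≠ b) (l : List ℕ) :
    (l.map (sb x y)).count b = l.count b := by
  induction l with
  | nil => rfl
  | cons c l ih =>
    simp only [List.map, List.count_cons, ih, sb]
    grind

theorem no_odd {C : PartitionCategory} (hH : Hyperoctahedral C) (hG : ¬ GroupTheoretical C)
    (n : ℕ) : ∀ (a b : ℕ) (X V : List ℕ), X.length = n → a ≠ b → Odd (X.count b) →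
      TT C [] (a :: X ++ a :: V) → False := by
  induction n using Nat.strong_induction_on with
  | _ n ih =>
  intro a b X V hn hab hodd h
  by_cases hnd : X.Nodup
  · rcases X with _ | ⟨c, X⟩
    · simp at hodd
    by_cases hcb : c = b
    · subst hcb
      rcases List.eq_nil_or_concat X with rfl | ⟨X', d, rfl⟩
      · exact final_step hH hG hab h
      · have hdc : d ≠ c := by
          rintro rfl
          simp at hnd
        have h1 := TT_rot (u := a :: c :: X') (v := d :: a :: V) (by simpa using h)
        have h2 := TT_merge hH h1
        have h3 := TT_rot (u := d :: d :: V.map (sb d a)) (v := (a :: c :: X').map (sb d a))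
          (by simpa using h2)
        refine ih (X'.length + 1) (by simp at hn; omega) d c ((c :: X').map (sb d a))
          (d :: V.map (sb d a)) (by simp) hdc ?_ ?_
        · rw [count_sb hdc hab]
          simpa [List.count_append, List.count_cons, hdc] using hodd
        · simpa [sb] using h3
    · have h2 := TT_merge hH h
      have h3 := TT_rot (u := [a]) h2
      refine ih X.length (by simp at hn; omega) a b (X.map (sb a c))
        (V.map (sb a c) ++ [a]) (by simp) hab ?_ ?_
      · rw [count_sb hab hcb]
        simpa [List.count_cons, hcb] using hodd
      · have : sb a c a = a := by simp [sb]
        simpa [this] using h3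
  · obtain ⟨P, x, Z, Q, rfl, hZ, hxZ⟩ := dup_split X hnd
    rcases Z with _ | ⟨z, Z⟩
    · have h1 := TT_rot (u := a :: P) (v := x :: x :: (Q ++ a :: V)) (by simpa using h)
      have h2 := TT_rot (u := Q ++ a :: V) (v := a :: P) (TT_del h1)
      refine ih (P ++ Q).length (by simp at hn ⊢; omega) a b (P ++ Q) V rfl hab ?_
        (by simpa using h2)
      simp only [List.append_assoc, List.count_append, List.count_cons, List.count_nil] at hodd ⊢
      split_ifs at hodd <;> grind
    · have h1 := TT_rot (u := a :: P) (v := x :: z :: Z ++ x :: (Q ++ a :: V))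
        (by simpa using h)
      refine ih (z :: Z).length (by simp at hn ⊢; omega) x z (z :: Z) (Q ++ a :: V ++ a :: P) rfl
        ?_ ?_ (by simpa using h1)
      · rintro rfl; simp at hxZ
      · rw [List.count_eq_one_of_mem hZ (by simp)]; exact odd_one

theorem statement12 (C : PartitionCategory) (hH : Hyperoctahedral C)
    (hG : ¬ GroupTheoretical C) (a : ℕ) (X₁ X₂ X₃ : List ℕ)
    (hp : (⟨0, _, ofList (X₁ ++ [a] ++ X₂ ++ [a] ++ X₃)⟩ :
        Σ k l : ℕ, Partition k l) ∈ C.mem) :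
    (∀ b : ℕ, b ≠ a → Even (X₂.count b)) ∧
    (Odd X₂.length → a ∈ X₂) ∧
    (Even X₂.length → 2 ≤ X₂.length → ∃ (Y₁ : List ℕ) (b : ℕ) (Y₂ : List ℕ),
      X₂ = Y₁ ++ b :: b :: Y₂) := by
  have hp' : TT C [] ((X₁ ++ [a]) ++ X₂ ++ [a] ++ X₃) := by
    refine TT_of C (k := 0) (l := (X₁ ++ [a] ++ X₂ ++ [a] ++ X₃).length) Fin.elim0
      (X₁ ++ [a] ++ X₂ ++ [a] ++ X₃).get rfl rfl (fun i => i.elim0) ?_ hp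
    intro i
    simp
  have hw := TT_rot (u := X₁) (v := a :: X₂ ++ a :: X₃) (by simpa using hp')
  have ha : ∀ b : ℕ, b ≠ a → Even (X₂.count b) := by
    intro b hb
    by_contra hne
    exact no_odd hH hG X₂.length a b X₂ (X₃ ++ X₁) rfl hb.symm (Nat.not_even_iff_odd.1 hne)
      (by simpa using hw)
  refine ⟨ha, ?_, ?_⟩
  · intro hodd
    by_contra hna
    have : Even X₂.length := by
      rw [← List.sum_toFinset_count_eq_length X₂]
      refine Finset.even_sum _ (fun b hb => ha b ?_)
      rintro rfl
      exact hna (by simpa using hb)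
    exact (Nat.not_even_iff_odd.2 hodd) this
  · intro _ hlen
    have hnd : ¬ X₂.Nodup := by
      intro hnd
      have hall : ∀ b ∈ X₂, b = a := by
        intro b hb
        by_contra hne
        have := ha b hne
        rw [List.count_eq_one_of_mem hnd hb] at this
        exact absurd this (by decide)
      have hr := List.eq_replicate_of_mem hall
      rw [hr, List.nodup_replicate] at hnd
      omega
    obtain ⟨P, x, Z, Q, rfl, hZ, hxZ⟩ := dup_split X₂ hnd
    rcases Z with _ | ⟨z, Z⟩
    · exact ⟨P, x, Q, by simp⟩
    · exfalso
      have h1 := TT_rot (u := X₁ ++ a :: P) (v := x :: z :: Z ++ x :: (Q ++ a :: X₃))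
        (by simpa using hp')
      refine no_odd hH hG (z :: Z).length x z (z :: Z) (Q ++ a :: X₃ ++ (X₁ ++ a :: P)) rfl
        ?_ ?_ (by simpa using h1)
      · rintro rfl; simp at hxZ
      · rw [List.count_eq_one_of_mem hZ (by simp)]; exact odd_one

end EasyQG
end
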